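/- arXiv:2401.09235 — 10 statements merged into one kernel-verified Lean document; each statement's English description precedes it below -/
import Mathlib

section
/- Let n ≥ 1. An invertible real n×n matrix M commutes with the induced map of every continuous function f : ℝ → ℝ if and only if M is a permutation matrix; and a continuous function f : ℝ → ℝ commutes with every n×n permutation matrix. Equivalently, 𝓜(C(ℝ)) is exactly the set of n×n permutation matrices, and 𝓕(permutation matrices) is exactly the set of all continuous functions ℝ → ℝ. -/
/-- The coordinatewise induced map `f̃ : ℝⁿ → ℝⁿ` of `f : ℝ → ℝ`. -/
def inducedMap (n : ℕ) (f : ℝ → ℝ) : (Fin n → ℝ) → (Fin n → ℝ) :=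
  fun v i => f (v i)

/-- `f` commutes with the matrix `M`: `f̃(Mv) = M f̃(v)` for all `v`. -/
def CommutesWith (n : ℕ) (f : ℝ → ℝ) (M : Matrix (Fin n) (Fin n) ℝ) : Prop :=
  ∀ v : Fin n → ℝ, inducedMap n f (M.mulVec v) = M.mulVec (inducedMap n f v)

/-- `𝓜(𝓕)`: the set of invertible `n×n` real matrices commuting with every `f ∈ 𝓕`. -/
def Mop (n : ℕ) (F : Set (ℝ → ℝ)) : Set (Matrix (Fin n) (Fin n) ℝ) :=
  {M | IsUnit M ∧ ∀ f ∈ F, CommutesWith n f M}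

/-- `𝓕(𝓜)`: the set of continuous functions `ℝ → ℝ` commuting with every `M ∈ 𝓜`. -/
def Fop (n : ℕ) (Ms : Set (Matrix (Fin n) (Fin n) ℝ)) : Set (ℝ → ℝ) :=
  {f | Continuous f ∧ ∀ M ∈ Ms, CommutesWith n f M}

/-- A matrix is monomial if every row and every column contains exactly one nonzero entry. -/
def IsMonomial {n : ℕ} (M : Matrix (Fin n) (Fin n) ℝ) : Prop :=
  (∀ i, ∃! j, M i j ≠ 0) ∧ (∀ j, ∃! i, M i j ≠ 0)

/-- A permutation matrix: monomial with all nonzero entries equal to `1`. -/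
def IsPermMatrix {n : ℕ} (M : Matrix (Fin n) (Fin n) ℝ) : Prop :=
  IsMonomial M ∧ ∀ i j, M i j ≠ 0 → M i j = 1

lemma perm_apply {n : ℕ} {M : Matrix (Fin n) (Fin n) ℝ} (h : IsPermMatrix M) :
    ∃ σ : Fin n → Fin n, Function.Injective σ ∧ ∀ i j, M i j = if σ i = j then 1 else 0 := by
  obtain ⟨⟨hr, hc⟩, h1⟩ := h
  choose σ hσ hu using hr
  refine ⟨σ, ?_, ?_⟩
  · intro a b hab
    refine (hc (σ a)).unique (hσ a) ?_
    rw [hab]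
    exact hσ b
  · intro i j
    split_ifs with hij
    · subst hij
      exact h1 _ _ (hσ i)
    · by_contra hne
      exact hij (hu i j hne).symm

lemma perm_commutes {n : ℕ} {M : Matrix (Fin n) (Fin n) ℝ} (h : IsPermMatrix M) (f : ℝ → ℝ) :
    CommutesWith n f M := by
  obtain ⟨σ, -, hM⟩ := perm_apply h
  intro v
  ext i
  simp [inducedMap, Matrix.mulVec, dotProduct, hM]

lemma perm_isUnit {n : ℕ} {M : Matrix (Fin n) (Fin n) ℝ} (h : IsPermMatrix M) :
    IsUnit M := by
  obtain ⟨σ, hσ, hM⟩ := perm_apply h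
  have : M * M.transpose = 1 := by
    ext i j
    simp [Matrix.mul_apply, hM, Matrix.one_apply, hσ.eq_iff, eq_comm]
  exact IsUnit.of_mul_eq_one _ this

lemma perm_of_commutes {n : ℕ} {M : Matrix (Fin n) (Fin n) ℝ} (hu : IsUnit M)
    (h : CommutesWith n (fun x => x ^ 2) M) : IsPermMatrix M := by
  have h1 : ∀ i j, M i j ^ 2 = M i j := by
    intro i j
    have := congrFun (h (Pi.single j 1)) i
    simpa [inducedMap, Matrix.mulVec, dotProduct, Pi.single_apply, ite_pow] using this
  have h2 : ∀ i j k, j ≠ k → M i j * M i k = 0 := by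
    intro i j k hjk
    have h0 := congrFun (h (Pi.single j 1 + Pi.single k 1)) i
    have e : inducedMap n (fun x => x ^ 2) (Pi.single j 1 + Pi.single k 1)
        = Pi.single j 1 + Pi.single k 1 := by
      ext l
      by_cases hl : l = j
      · subst hl
        simp [inducedMap, Pi.single_apply, hjk]
      · simp [inducedMap, Pi.single_apply, hl]
    rw [e, Matrix.mulVec_add] at h0
    simp [inducedMap] at h0
    nlinarith [h1 i j, h1 i k]
  obtain ⟨⟨A, N, hMN, hNM⟩, rfl⟩ := hu
  simp only at *
  have hrow : ∀ i, ∃ j, A i j ≠ 0 := by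
    intro i
    by_contra! hz
    have := congrFun (congrFun hMN i) i
    simp [Matrix.mul_apply, hz] at this
  have hcol : ∀ j, ∃ i, A i j ≠ 0 := by
    intro j
    by_contra! hz
    have := congrFun (congrFun hNM j) j
    simp [Matrix.mul_apply, hz] at this
  have huniq : ∀ i j k, A i j ≠ 0 → A i k ≠ 0 → j = k := by
    intro i j k hj hk
    by_contra hjk
    exact mul_ne_zero hj hk (h2 i j k hjk)
  choose σ hσ using hrow
  have hsurj : Function.Surjective σ := by
    intro j
    obtain ⟨i, hi⟩ := hcol j
    exact ⟨i, huniq i _ _ (hσ i) hi⟩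
  have hinj := Finite.injective_iff_surjective.mpr hsurj
  refine ⟨⟨fun i => ⟨σ i, hσ i, fun k hk => huniq i _ _ hk (hσ i)⟩, fun j => ?_⟩, ?_⟩
  · obtain ⟨i, hi⟩ := hcol j
    refine ⟨i, hi, fun k hk => hinj ?_⟩
    rw [huniq i _ _ (hσ i) hi, huniq k _ _ (hσ k) hk]
  · intro i j hij
    have := h1 i j
    rw [sq] at this
    exact mul_left_cancel₀ hij (by simpa using this)

/-- `𝓜(C(ℝ))` is exactly the set of permutation matrices and
`𝓕(permutation matrices)` is exactly the set of continuous functions. -/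
theorem stmt_3 (n : ℕ) (hn : 1 ≤ n) :
    Mop n {f : ℝ → ℝ | Continuous f} = {M | IsPermMatrix M} ∧
    Fop n {M | IsPermMatrix M} = {f : ℝ → ℝ | Continuous f} := by
  refine ⟨?_, ?_⟩
  · ext M
    exact ⟨fun h => perm_of_commutes h.1 (h.2 _ (continuous_pow 2)),
      fun h => ⟨perm_isUnit h, fun f _ => perm_commutes h f⟩⟩
  · ext f
    exact ⟨fun h => h.1, fun h => ⟨h, fun M hM => perm_commutes hM f⟩⟩
end

section
/- Let n ≥ 1. An invertible real n×n matrix M commutes with the induced map of every odd continuous function f : ℝ → ℝ if and only if M is a signed permutation matrix; and a continuous function f : ℝ → ℝ commutes with every n×n signed permutation matrix if and only if f is odd. Equivalently, 𝓜(odd continuous functions) is exactly the set of signed permutation matrices, and 𝓕(signed permutation matrices) is exactly the set of odd continuous functions. -/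
/-- A signed permutation matrix: monomial with all nonzero entries equal to `±1`. -/
def IsSignedPermMatrix {n : ℕ} (M : Matrix (Fin n) (Fin n) ℝ) : Prop :=
  IsMonomial M ∧ ∀ i j, M i j ≠ 0 → M i j = 1 ∨ M i j = -1

lemma row_mulVec {n : ℕ} {M : Matrix (Fin n) (Fin n) ℝ} {i j : Fin n}
    (h : ∀ k, M i k ≠ 0 → k = j) (v : Fin n → ℝ) : M.mulVec v i = M i j * v j := by
  simp only [Matrix.mulVec, dotProduct]
  refine Finset.sum_eq_single j (fun k _ hk => ?_) (by simp)
  have : M i k = 0 := by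
    by_contra h0
    exact hk (h k h0)
  simp [this]

lemma signed_commutes {n : ℕ} {M : Matrix (Fin n) (Fin n) ℝ} (hM : IsSignedPermMatrix M)
    {f : ℝ → ℝ} (hf : ∀ x, f (-x) = -f x) : CommutesWith n f M := by
  intro v
  funext i
  obtain ⟨j, hj, hu⟩ := hM.1.1 i
  rw [row_mulVec (fun k hk => hu k hk)]
  simp only [inducedMap]
  rw [row_mulVec (fun k hk => hu k hk)]
  rcases hM.2 i j hj with h | h <;> simp [h, hf]

lemma signed_isUnit {n : ℕ} {M : Matrix (Fin n) (Fin n) ℝ} (hM : IsSignedPermMatrix M) :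
    IsUnit M := by
  rw [← Matrix.mulVec_injective_iff_isUnit]
  intro v w hvw
  funext j
  obtain ⟨i, hi, -⟩ := hM.1.2 j
  obtain ⟨j', hj, hu⟩ := hM.1.1 i
  have hjj : j = j' := hu j hi
  subst hjj
  have := congrFun hvw i
  simp only [row_mulVec (fun k hk => hu k hk)] at this
  exact mul_left_cancel₀ hi this

lemma cube_signed {n : ℕ} {M : Matrix (Fin n) (Fin n) ℝ} (hU : IsUnit M)
    (hc : CommutesWith n (fun x => x ^ 3) M) : IsSignedPermMatrix M := by
  have h1 : ∀ i j, M i j ^ 3 = M i j := by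
    intro i j
    have := congrFun (hc (Pi.single j 1)) i
    have e : inducedMap n (fun x => x ^ 3) (Pi.single j 1) = Pi.single j 1 := by
      funext k
      by_cases h : k = j
      · subst h; simp [inducedMap]
      · simp [inducedMap, h]
    rw [e] at this
    simpa [inducedMap] using this
  have hpm : ∀ i j, M i j ≠ 0 → M i j = 1 ∨ M i j = -1 := by
    intro i j h
    have h2 : M i j * ((M i j - 1) * (M i j + 1)) = 0 := by linear_combination h1 i j
    rcases mul_eq_zero.1 h2 with h3 | h3
    · exact absurd h3 h
    · rcases mul_eq_zero.1 h3 with h4 | h4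
      · left; linarith
      · right; linarith
  have h2 : ∀ i j k, j ≠ k → ∀ s : ℝ, s ^ 3 = s →
      (M i j + M i k * s) ^ 3 = M i j + M i k * s := by
    intro i j k hjk s hs
    have := congrFun (hc (Pi.single j 1 + Pi.single k s)) i
    have e : inducedMap n (fun x => x ^ 3) (Pi.single j 1 + Pi.single k s)
        = Pi.single j 1 + Pi.single k s := by
      funext l
      by_cases h : l = j
      · subst h; simp [inducedMap, hjk]
      · by_cases h' : l = k
        · subst h'; simp [inducedMap, h, hs]
        · simp [inducedMap, h, h']
    rw [e] at this
    simpa [inducedMap, Matrix.mulVec_add, mul_comm] using this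
  have huniq : ∀ i j k, M i j ≠ 0 → M i k ≠ 0 → j = k := by
    intro i j k hj hk
    by_contra hjk
    have a := h2 i j k hjk 1 (by norm_num)
    have b := h2 i j k hjk (-1) (by norm_num)
    rcases hpm i j hj with h | h <;> rcases hpm i k hk with h' | h' <;>
      rw [h, h'] at a b <;> revert a b <;> norm_num
  have hrow : ∀ i, ∃ j, M i j ≠ 0 := by
    intro i
    by_contra! h
    have hd := (Matrix.isUnit_iff_isUnit_det M).1 hU
    rw [Matrix.det_eq_zero_of_row_eq_zero i h] at hd
    simp at hd
  have hcol : ∀ j, ∃ i, M i j ≠ 0 := by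
    intro j
    by_contra! h
    have hd := (Matrix.isUnit_iff_isUnit_det M).1 hU
    rw [Matrix.det_eq_zero_of_column_eq_zero j h] at hd
    simp at hd
  choose σ hσ using hrow
  have hsurj : Function.Surjective σ := by
    intro j
    obtain ⟨i, hi⟩ := hcol j
    exact ⟨i, huniq i _ _ (hσ i) hi⟩
  have hinj : Function.Injective σ := Finite.injective_iff_surjective.2 hsurj
  refine ⟨⟨fun i => ⟨σ i, hσ i, fun k hk => huniq i _ _ hk (hσ i)⟩, fun j => ?_⟩, hpm⟩
  obtain ⟨i, hi⟩ := hcol j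
  refine ⟨i, hi, fun k hk => hinj ?_⟩
  rw [huniq k _ _ (hσ k) hk, huniq i _ _ (hσ i) hi]

lemma neg_one_signed (n : ℕ) : IsSignedPermMatrix (-1 : Matrix (Fin n) (Fin n) ℝ) := by
  refine ⟨⟨fun i => ⟨i, by simp, fun k hk => ?_⟩, fun i => ⟨i, by simp, fun k hk => ?_⟩⟩,
    fun i j h => ?_⟩
  · by_contra h
    exact hk (by simp [Matrix.one_apply_ne (Ne.symm h)])
  · by_contra h
    exact hk (by simp [Matrix.one_apply_ne h])
  · by_cases e : i = j
    · subst e; simp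
    · exact absurd (by simp [Matrix.one_apply_ne e]) h

/-- `𝓜(odd continuous functions)` is exactly the set of signed permutation matrices and
`𝓕(signed permutation matrices)` is exactly the set of odd continuous functions. -/
theorem stmt_4 (n : ℕ) (hn : 1 ≤ n) :
    Mop n {f : ℝ → ℝ | Continuous f ∧ ∀ x, f (-x) = -f x} = {M | IsSignedPermMatrix M} ∧
    Fop n {M | IsSignedPermMatrix M} = {f : ℝ → ℝ | Continuous f ∧ ∀ x, f (-x) = -f x} := by
  constructor
  · ext M
    constructor
    · rintro ⟨hU, h⟩
      exact cube_signed hU (h _ ⟨by fun_prop, fun x => by ring⟩)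
    · intro hM
      exact ⟨signed_isUnit hM, fun f hf => signed_commutes hM hf.2⟩
  · ext f
    constructor
    · rintro ⟨hc, h⟩
      refine ⟨hc, fun x => ?_⟩
      have := congrFun (h _ (neg_one_signed n) (fun _ => x)) ⟨0, hn⟩
      simpa [inducedMap, Matrix.neg_mulVec] using this
    · rintro ⟨hc, h⟩
      exact ⟨hc, fun M hM => signed_commutes hM h⟩
end

section
/- Let n ≥ 1 and let b > 1 be a real number. An invertible real n×n matrix M commutes with the induced map of every continuous b-multiplicative function f : ℝ → ℝ if and only if M is a b-monomial matrix; and a continuous function f : ℝ → ℝ commutes with every n×n b-monomial matrix if and only if f is b-multiplicative. Equivalently, 𝓜(continuous b-multiplicative functions) is exactly the set of b-monomial matrices, and 𝓕(b-monomial matrices) is exactly the set of continuous b-multiplicative functions. -/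
/-- A `b`-monomial matrix: monomial with all nonzero entries in `{bᵏ : k ∈ ℤ}`. -/
def IsBMonomial (b : ℝ) {n : ℕ} (M : Matrix (Fin n) (Fin n) ℝ) : Prop :=
  IsMonomial M ∧ ∀ i j, M i j ≠ 0 → ∃ k : ℤ, M i j = b ^ k

/-- `f` is `b`-multiplicative: `f(bᵏx) = bᵏ f(x)` for all `k ∈ ℤ`, `x ∈ ℝ`. -/
def BMult (b : ℝ) (f : ℝ → ℝ) : Prop :=
  ∀ (k : ℤ) (x : ℝ), f (b ^ k * x) = b ^ k * f x

/-- Auxiliary test function. -/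
noncomputable def auxG (b : ℝ) (x : ℝ) : ℝ :=
  x * (1 - Real.cos (Real.log x / Real.log b * (2 * Real.pi)))

lemma auxG_cont (b : ℝ) : Continuous (auxG b) := by
  rw [continuous_iff_continuousAt]
  intro x
  by_cases hx : x = 0
  · subst hx
    have h0 : auxG b 0 = 0 := by simp [auxG]
    unfold ContinuousAt
    rw [h0]
    apply squeeze_zero_norm (a := fun x => |x| * 2)
    · intro t
      unfold auxG
      rw [Real.norm_eq_abs, abs_mul]
      gcongr
      rw [abs_le]
      constructor <;> linarith [Real.neg_one_le_cos (Real.log t / Real.log b * (2 * Real.pi)),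
        Real.cos_le_one (Real.log t / Real.log b * (2 * Real.pi))]
    · have : Continuous (fun x : ℝ => |x| * 2) := by fun_prop
      simpa using this.tendsto 0
  · unfold auxG
    have := Real.continuousAt_log hx
    fun_prop

lemma auxG_mult (b : ℝ) (hb : 1 < b) : BMult b (auxG b) := by
  intro k x
  by_cases hx : x = 0
  · subst hx; simp [auxG]
  have hl : Real.log b ≠ 0 := (Real.log_pos hb).ne'
  have hk : b ^ k ≠ 0 := zpow_ne_zero _ (by linarith)
  unfold auxG
  rw [Real.log_mul hk hx, Real.log_zpow]
  have : ((k : ℝ) * Real.log b + Real.log x) / Real.log b * (2 * Real.pi)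
      = Real.log x / Real.log b * (2 * Real.pi) + k * (2 * Real.pi) := by
    field_simp; ring
  rw [this, Real.cos_add_int_mul_two_pi]
  ring

lemma auxG_zero (b : ℝ) (hb : 1 < b) (x : ℝ) (hx : 0 < x) (h : auxG b x = 0) :
    ∃ k : ℤ, x = b ^ k := by
  have hl : Real.log b ≠ 0 := (Real.log_pos hb).ne'
  unfold auxG at h
  rcases mul_eq_zero.1 h with h | h
  · exact absurd h hx.ne'
  obtain ⟨k, hk⟩ := (Real.cos_eq_one_iff _).1 (sub_eq_zero.1 h).symm
  refine ⟨k, ?_⟩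
  have h2 : (k : ℝ) = Real.log x / Real.log b :=
    mul_right_cancel₀ (by positivity : (2 * Real.pi) ≠ 0) hk
  apply Real.log_injOn_pos (Set.mem_Ioi.2 hx) (Set.mem_Ioi.2 (zpow_pos (by linarith) k))
  rw [Real.log_zpow, h2]
  field_simp

lemma abs_bmult (b : ℝ) (hb : 1 < b) : BMult b (fun x => |x|) := by
  intro k x
  simp only [abs_mul]
  rw [abs_of_pos (zpow_pos (by linarith : (0:ℝ) < b) k)]

lemma bmono_mulVec {n : ℕ} {M : Matrix (Fin n) (Fin n) ℝ} {i j : Fin n}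
    (h : ∀ l, M i l ≠ 0 → l = j) (v : Fin n → ℝ) : M.mulVec v i = M i j * v j := by
  unfold Matrix.mulVec dotProduct
  apply Finset.sum_eq_single j
  · intro l _ hl
    have : M i l = 0 := by
      by_contra h'
      exact hl (h l h')
    simp [this]
  · simp

theorem stmt_6 (n : ℕ) (hn : 1 ≤ n) (b : ℝ) (hb : 1 < b) :
    Mop n {f : ℝ → ℝ | Continuous f ∧ BMult b f} = {M | IsBMonomial b M} ∧
    Fop n {M | IsBMonomial b M} = {f : ℝ → ℝ | Continuous f ∧ BMult b f} := by
  have hcomm : ∀ M : Matrix (Fin n) (Fin n) ℝ, IsBMonomial b M → ∀ f, BMult b f →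
      CommutesWith n f M := by
    intro M hM f hf v
    funext i
    obtain ⟨j, hj, hj'⟩ := hM.1.1 i
    obtain ⟨k, hk⟩ := hM.2 i j hj
    rw [bmono_mulVec hj']
    simp only [inducedMap]
    rw [bmono_mulVec hj', hk, hf]
  constructor
  · ext M
    constructor
    · rintro ⟨hu, hM⟩
      have habs := hM (fun x => |x|) ⟨continuous_abs, abs_bmult b hb⟩
      have hg := hM (auxG b) ⟨auxG_cont b, auxG_mult b hb⟩
      have hinj := Matrix.mulVec_injective_iff_isUnit.2 hu
      have hsurj := Matrix.mulVec_surjective_iff_isUnit.2 hu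
      have hnn : ∀ i j, 0 ≤ M i j := by
        intro i j
        have := congrFun (habs (Pi.single j 1)) i
        have e : inducedMap n (fun x : ℝ => |x|) (Pi.single j 1) = Pi.single j 1 := by
          funext l
          by_cases h : l = j
          · subst h; simp [inducedMap]
          · simp [inducedMap, h]
        rw [e] at this
        simp [inducedMap] at this
        exact this
      have hpow : ∀ i j, M i j ≠ 0 → ∃ k : ℤ, M i j = b ^ k := by
        intro i j hij
        apply auxG_zero b hb _ (lt_of_le_of_ne (hnn i j) hij.symm)
        have := congrFun (hg (Pi.single j 1)) i
        have e : inducedMap n (auxG b) (Pi.single j 1) = 0 := by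
          funext l
          by_cases h : l = j
          · subst h; simp [inducedMap, auxG]
          · simp [inducedMap, h, auxG]
        rw [e] at this
        simpa [inducedMap] using this
      have huniq : ∀ i j l, M i j ≠ 0 → M i l ≠ 0 → j = l := by
        intro i j l hj hl
        by_contra hne
        have := congrFun (habs (Pi.single j (M i l) - Pi.single l (M i j))) i
        have e : inducedMap n (fun x : ℝ => |x|) (Pi.single j (M i l) - Pi.single l (M i j))
            = Pi.single j (M i l) + Pi.single l (M i j) := by
          funext m
          by_cases h : m = j
          · subst h; simp [inducedMap, hne, abs_of_nonneg (hnn _ _)]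
          · by_cases h' : m = l
            · subst h'; simp [inducedMap, h, abs_of_nonneg (hnn _ _)]
            · simp [inducedMap, h, h']
        rw [e] at this
        simp only [inducedMap, Matrix.mulVec_sub, Matrix.mulVec_add, Matrix.mulVec_single,
          Pi.sub_apply, Pi.add_apply] at this
        simp [mul_comm] at this
        have p : 0 < M i j * M i l := mul_pos (lt_of_le_of_ne (hnn _ _) hj.symm)
          (lt_of_le_of_ne (hnn _ _) hl.symm)
        first
          | (exact this.elim hj hl)
          | (rcases this with h | h <;> contradiction)
          | nlinarith
      have hrow : ∀ i, ∃ j, M i j ≠ 0 := by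
        intro i
        by_contra! h
        obtain ⟨v, hv⟩ := hsurj (Pi.single i 1)
        have := congrFun hv i
        simp [Matrix.mulVec, dotProduct, h] at this
      have hcol : ∀ j, ∃ i, M i j ≠ 0 := by
        intro j
        by_contra! h
        have : M.mulVec (Pi.single j 1) = M.mulVec 0 := by
          funext i; simp [h]
        have := congrFun (hinj this) j
        simp at this
      choose σ hσ using hrow
      have hs : Function.Surjective σ := by
        intro j
        obtain ⟨i, hi⟩ := hcol j
        exact ⟨i, huniq i _ _ (hσ i) hi⟩
      have hi := Finite.injective_iff_surjective.2 hs
      refine ⟨⟨fun i => ⟨σ i, hσ i, fun l hl => huniq i _ _ hl (hσ i)⟩, fun j => ?_⟩, hpow⟩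
      obtain ⟨i, rfl⟩ := hs j
      exact ⟨i, hσ i, fun l hl => hi (huniq l _ _ (hσ l) hl)⟩
    · intro hM
      refine ⟨?_, fun f hf => hcomm M hM f hf.2⟩
      rw [← Matrix.mulVec_injective_iff_isUnit]
      intro v w hvw
      funext j
      obtain ⟨i, hi, -⟩ := hM.1.2 j
      obtain ⟨l, hl, hl'⟩ := hM.1.1 i
      obtain rfl := hl' j hi
      have := congrFun hvw i
      simp only [bmono_mulVec hl'] at this
      exact mul_left_cancel₀ hi this
  · ext f
    constructor
    · rintro ⟨hc, hf⟩
      refine ⟨hc, fun k x => ?_⟩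
      have hk : b ^ k ≠ 0 := zpow_ne_zero _ (by linarith)
      have hM : IsBMonomial b (Matrix.diagonal (fun _ : Fin n => b ^ k)) := by
        refine ⟨⟨fun i => ⟨i, by simpa using hk, fun l hl => ?_⟩,
          fun i => ⟨i, by simpa using hk, fun l hl => ?_⟩⟩, fun i j hij => ⟨k, ?_⟩⟩
        · by_contra h
          exact hl (Matrix.diagonal_apply_ne _ (Ne.symm h))
        · by_contra h
          exact hl (Matrix.diagonal_apply_ne _ h)
        · by_cases h : i = j
          · subst h; simp
          · exact absurd (Matrix.diagonal_apply_ne _ h) hij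
      have := congrFun (hf _ hM (fun _ => x)) ⟨0, hn⟩
      simpa [inducedMap, Matrix.mulVec_diagonal] using this
    · rintro ⟨hc, hf⟩
      exact ⟨hc, fun M hM => hcomm M hM f hf⟩
end

section
/- Let n ≥ 1 and let b > 1 be a real number. An invertible real n×n matrix M commutes with the induced map of every continuous ±b-multiplicative function f : ℝ → ℝ if and only if M is a ±b-monomial matrix; and a continuous function f : ℝ → ℝ commutes with every n×n ±b-monomial matrix if and only if f is ±b-multiplicative. Equivalently, 𝓜(continuous ±b-multiplicative functions) is exactly the set of ±b-monomial matrices, and 𝓕(±b-monomial matrices) is exactly the set of continuous ±b-multiplicative functions. -/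
/-- A `±b`-monomial matrix: monomial with all nonzero entries in `{±bᵏ : k ∈ ℤ}`. -/
def IsPMBMonomial (b : ℝ) {n : ℕ} (M : Matrix (Fin n) (Fin n) ℝ) : Prop :=
  IsMonomial M ∧ ∀ i j, M i j ≠ 0 → ∃ k : ℤ, M i j = b ^ k ∨ M i j = -(b ^ k)

/-- `f` is `±b`-multiplicative: `f(εbᵏx) = εbᵏ f(x)` for all `k ∈ ℤ`, `ε ∈ {1,-1}`, `x ∈ ℝ`. -/
def PMBMult (b : ℝ) (f : ℝ → ℝ) : Prop :=
  ∀ (k : ℤ) (ε : ℝ), (ε = 1 ∨ ε = -1) → ∀ x : ℝ, f (ε * b ^ k * x) = ε * b ^ k * f x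

noncomputable def testFn (b : ℝ) (x : ℝ) : ℝ := x * Real.cos (2 * Real.pi * (Real.log x / Real.log b))

lemma testFn_continuous (b : ℝ) : Continuous (testFn b) := by
  rw [continuous_iff_continuousAt]
  intro x
  by_cases hx : x = 0
  · subst hx
    have h0 : testFn b 0 = 0 := by simp [testFn]
    unfold ContinuousAt
    rw [h0]
    apply squeeze_zero_norm (a := fun x : ℝ => |x|)
    · intro t
      unfold testFn
      rw [norm_mul, Real.norm_eq_abs, Real.norm_eq_abs]
      exact mul_le_of_le_one_right (abs_nonneg _) (Real.abs_cos_le_one _)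
    · simpa using (continuous_abs (G := ℝ)).tendsto 0
  · have h1 : ContinuousAt Real.log x := Real.continuousAt_log hx
    unfold testFn
    exact continuousAt_id.mul (Real.continuous_cos.continuousAt.comp
      (continuousAt_const.mul (h1.div_const _)))

lemma testFn_mult (b : ℝ) (hb : 1 < b) : PMBMult b (testFn b) := by
  intro k ε hε x
  have hl : Real.log b ≠ 0 := (Real.log_pos hb).ne'
  have hbk : b ^ k ≠ 0 := zpow_ne_zero _ (by linarith)
  by_cases hx : x = 0
  · simp [hx, testFn]
  have key : Real.log (ε * b ^ k * x) = k * Real.log b + Real.log x := by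
    rcases hε with rfl | rfl
    · rw [one_mul, Real.log_mul hbk hx, Real.log_zpow]
    · rw [show (-1 : ℝ) * b ^ k * x = -(b ^ k * x) by ring, Real.log_neg_eq_log,
        Real.log_mul hbk hx, Real.log_zpow]
  unfold testFn
  rw [key, show 2 * Real.pi * ((k * Real.log b + Real.log x) / Real.log b)
    = 2 * Real.pi * (Real.log x / Real.log b) + k * (2 * Real.pi) by field_simp; ring,
    Real.cos_add_int_mul_two_pi]
  ring

lemma testFn_one (b : ℝ) : testFn b 1 = 1 := by simp [testFn]

lemma testFn_zero (b : ℝ) : testFn b 0 = 0 := by simp [testFn]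

lemma testFn_detect (b : ℝ) (hb : 1 < b) (a : ℝ) (ha : a ≠ 0) (h : testFn b a = a) :
    ∃ k : ℤ, a = b ^ k ∨ a = -(b ^ k) := by
  have hl : Real.log b ≠ 0 := (Real.log_pos hb).ne'
  have hc : Real.cos (2 * Real.pi * (Real.log a / Real.log b)) = 1 := by
    unfold testFn at h
    exact mul_left_cancel₀ ha (by rw [h, mul_one])
  obtain ⟨k, hk⟩ := (Real.cos_eq_one_iff _).1 hc
  have hk2 : Real.log a = k * Real.log b := by
    have h2 : (k : ℝ) = Real.log a / Real.log b := by
      apply mul_right_cancel₀ (b := 2 * Real.pi) (by positivity)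
      rw [hk]; ring
    rw [h2]; field_simp
  have hbk : 0 < b ^ k := zpow_pos (by linarith) _
  have h3 : |a| = b ^ k := by
    apply Real.log_injOn_pos (abs_pos.2 ha) hbk
    rw [Real.log_abs, Real.log_zpow, hk2]
  refine ⟨k, ?_⟩
  rcases abs_choice a with h4 | h4
  · left; rw [← h3, h4]
  · right; rw [← h3, h4]; ring

lemma testFn_not_additive (b : ℝ) (hb : 1 < b)
    (h : ∀ x y, testFn b (x + y) = testFn b x + testFn b y) : False := by
  have hl : Real.log b ≠ 0 := (Real.log_pos hb).ne'
  have h1 := map_real_smul (AddMonoidHom.mk' (testFn b) h) (testFn_continuous b) (√b) 1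
  simp only [AddMonoidHom.mk'_apply, smul_eq_mul, mul_one, testFn_one] at h1
  have hs : 0 < √b := Real.sqrt_pos.2 (by linarith)
  unfold testFn at h1
  rw [Real.log_sqrt (by linarith), show 2 * Real.pi * (Real.log b / 2 / Real.log b) = Real.pi by
    field_simp, Real.cos_pi] at h1
  linarith

lemma monomial_commutes {n : ℕ} {b : ℝ} {M : Matrix (Fin n) (Fin n) ℝ}
    (hM : IsPMBMonomial b M) {f : ℝ → ℝ} (hf : PMBMult b f) : CommutesWith n f M := by
  intro v
  ext i
  obtain ⟨j, hj, hu⟩ := hM.1.1 i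
  have hrow : ∀ w : Fin n → ℝ, M.mulVec w i = M i j * w j := by
    intro w
    unfold Matrix.mulVec dotProduct
    apply Finset.sum_eq_single j
    · intro k _ hk
      have : M i k = 0 := by
        by_contra h
        exact hk (hu k h)
      show M i k * w k = 0
      rw [this, zero_mul]
    · simp
  rw [hrow]
  unfold inducedMap
  rw [hrow]
  obtain ⟨k, hk | hk⟩ := hM.2 i j hj
  · have := hf k 1 (Or.inl rfl) (v j)
    rw [hk]; simpa using this
  · have := hf k (-1) (Or.inr rfl) (v j)
    rw [hk]; simpa using this

lemma monomial_isUnit {n : ℕ} {M : Matrix (Fin n) (Fin n) ℝ}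
    (hM : IsMonomial M) : IsUnit M := by
  rw [← Matrix.mulVec_injective_iff_isUnit]
  intro v w hvw
  ext j
  obtain ⟨i, hi, -⟩ := hM.2 j
  obtain ⟨j', hj', hu⟩ := hM.1 i
  have hjj := hu j hi
  have hrow : ∀ w : Fin n → ℝ, M.mulVec w i = M i j * w j := by
    intro w
    unfold Matrix.mulVec dotProduct
    apply Finset.sum_eq_single j
    · intro k _ hk
      have : M i k = 0 := by
        by_contra h
        exact hk ((hu k h).trans hjj.symm)
      show M i k * w k = 0
      rw [this, zero_mul]
    · simp
  have h := congrFun hvw i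
  simp only [hrow] at h
  exact mul_left_cancel₀ hi h

lemma commutes_monomial {n : ℕ} {b : ℝ} (hb : 1 < b) {M : Matrix (Fin n) (Fin n) ℝ}
    (hU : IsUnit M) (hc : CommutesWith n (testFn b) M) : IsPMBMonomial b M := by
  have hone : ∀ i j x, testFn b (M i j * x) = M i j * testFn b x := by
    intro i j x
    have h := congrFun (hc (Pi.single j x)) i
    have h2 : inducedMap n (testFn b) (Pi.single j x) = Pi.single j (testFn b x) := by
      ext k
      unfold inducedMap
      by_cases hk : k = j
      · subst hk; simp
      · simp [hk, testFn_zero]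
    rw [h2] at h
    simpa [inducedMap, Matrix.mulVec_single, mul_comm] using h
  have hrow : ∀ i j k, M i j ≠ 0 → M i k ≠ 0 → j = k := by
    intro i j k hj hk
    by_contra hjk
    apply testFn_not_additive b hb
    intro x y
    have h := congrFun (hc (Pi.single j (x / M i j) + Pi.single k (y / M i k))) i
    have h2 : inducedMap n (testFn b) (Pi.single j (x / M i j) + Pi.single k (y / M i k))
        = Pi.single j (testFn b (x / M i j)) + Pi.single k (testFn b (y / M i k)) := by
      ext l
      unfold inducedMap
      by_cases hl : l = j
      · subst hl; simp [hjk]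
      · by_cases hl2 : l = k
        · subst hl2; simp [hl]
        · simp [hl, hl2, testFn_zero]
    rw [h2, Matrix.mulVec_add] at h
    unfold inducedMap at h
    rw [Matrix.mulVec_add] at h
    simp only [Pi.add_apply, Matrix.mulVec_single, Pi.smul_apply, Matrix.col_apply,
      MulOpposite.smul_eq_mul_unop, MulOpposite.unop_op] at h
    rw [← hone, ← hone, mul_div_cancel₀ _ hj, mul_div_cancel₀ _ hk] at h
    exact h
  have hrne : ∀ i, ∃ j, M i j ≠ 0 := by
    intro i
    by_contra! h
    exact ((Matrix.isUnit_iff_isUnit_det M).1 hU).ne_zero (Matrix.det_eq_zero_of_row_eq_zero i h)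
  have hcne : ∀ j, ∃ i, M i j ≠ 0 := by
    intro j
    by_contra! h
    exact ((Matrix.isUnit_iff_isUnit_det M).1 hU).ne_zero
      (Matrix.det_eq_zero_of_column_eq_zero j h)
  choose σ hσ using hrne
  have hsurj : Function.Surjective σ := by
    intro j
    obtain ⟨i, hi⟩ := hcne j
    exact ⟨i, hrow i _ _ (hσ i) hi⟩
  have hinj : Function.Injective σ := Finite.injective_iff_surjective.2 hsurj
  refine ⟨⟨fun i => ⟨σ i, hσ i, fun j hj => hrow i _ _ hj (hσ i)⟩, fun j => ?_⟩, ?_⟩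
  · obtain ⟨i, hi⟩ := hcne j
    refine ⟨i, hi, fun i' hi' => hinj ?_⟩
    rw [hrow i' _ _ (hσ i') hi', hrow i _ _ (hσ i) hi]
  · intro i j hij
    apply testFn_detect b hb _ hij
    simpa [testFn_one] using hone i j 1

/-- `𝓜(continuous ±b-multiplicative functions)` is exactly the set of `±b`-monomial matrices
and `𝓕(±b-monomial matrices)` is exactly the set of continuous `±b`-multiplicative functions. -/
theorem stmt_7 (n : ℕ) (hn : 1 ≤ n) (b : ℝ) (hb : 1 < b) :
    Mop n {f : ℝ → ℝ | Continuous f ∧ PMBMult b f} = {M | IsPMBMonomial b M} ∧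
    Fop n {M | IsPMBMonomial b M} = {f : ℝ → ℝ | Continuous f ∧ PMBMult b f} := by
  constructor
  · ext M
    constructor
    · rintro ⟨hU, h⟩
      exact commutes_monomial hb hU (h _ ⟨testFn_continuous b, testFn_mult b hb⟩)
    · intro hM
      exact ⟨monomial_isUnit hM.1, fun f hf => monomial_commutes hM hf.2⟩
  · ext f
    constructor
    · rintro ⟨hf, h⟩
      refine ⟨hf, fun k ε hε x => ?_⟩
      have hbk : b ^ k ≠ 0 := zpow_ne_zero _ (by linarith)
      have hne : ε * b ^ k ≠ 0 := by
        rcases hε with rfl | rfl <;> simp [hbk]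
      have hm : IsPMBMonomial b (Matrix.diagonal (fun _ : Fin n => ε * b ^ k)) := by
        have hd : ∀ i j : Fin n, Matrix.diagonal (fun _ : Fin n => ε * b ^ k) i j ≠ 0 → i = j := by
          intro i j hij
          by_contra hne'
          exact hij (Matrix.diagonal_apply_ne _ hne')
        refine ⟨⟨fun i => ⟨i, ?_, fun j hj => (hd i j hj).symm⟩,
          fun j => ⟨j, ?_, fun i hi => hd i j hi⟩⟩, ?_⟩
        · simpa using hne
        · simpa using hne
        · intro i j hij
          have := hd i j hij
          subst this
          refine ⟨k, ?_⟩
          rcases hε with rfl | rfl <;> simp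
      have h1 := congrFun (h _ hm (fun _ => x)) ⟨0, hn⟩
      simpa [inducedMap, Matrix.mulVec_diagonal] using h1
    · rintro ⟨hf, h⟩
      exact ⟨hf, fun M hM => monomial_commutes hM h⟩
end

section
/- Let b > 1 be a real number. A continuous function f : ℝ → ℝ is b-multiplicative if and only if f(0) = 0 and there exist continuous functions η₊, η₋ : [1, b] → ℝ with η₊(b) = b·η₊(1) and η₋(b) = b·η₋(1) such that: for every x > 0, f(x) = bⁿ·η₊(x·b⁻ⁿ) where n is the unique integer with x·b⁻ⁿ ∈ [1, b); and for every x < 0, f(x) = bⁿ·η₋(−x·b⁻ⁿ) where n is the unique integer with −x·b⁻ⁿ ∈ [1, b). Conversely, for any such continuous η₊, η₋ satisfying η±(b) = b·η±(1), the function defined piecewise by these formulas (with value 0 at 0) is continuous on ℝ and b-multiplicative. -/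
theorem half_exists (b : ℝ) (hb : 1 < b) (x : ℝ) (hx : 0 < x) :
    ∃ n : ℤ, x * b ^ (-n) ∈ Set.Ico 1 b := by
  obtain ⟨n, hn1, hn2⟩ := exists_mem_Ico_zpow hx hb
  have hp : 0 < b ^ n := zpow_pos (by linarith) n
  refine ⟨n, ?_, ?_⟩
  · rw [zpow_neg, ← div_eq_mul_inv, le_div_iff₀ hp]; linarith
  · rw [zpow_neg, ← div_eq_mul_inv, div_lt_iff₀ hp]
    rw [zpow_add_one₀ (by linarith)] at hn2; linarith

theorem half_mult (b : ℝ) (hb : 1 < b) (η g : ℝ → ℝ)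
    (hg : ∀ x : ℝ, 0 < x → ∀ n : ℤ, x * b ^ (-n) ∈ Set.Ico 1 b →
          g x = b ^ n * η (x * b ^ (-n))) (k : ℤ) (x : ℝ) (hx : 0 < x) :
    g (b ^ k * x) = b ^ k * g x := by
  have hb0 : b ≠ 0 := by linarith
  obtain ⟨n, hn⟩ := half_exists b hb x hx
  have hp : 0 < b ^ k := zpow_pos (by linarith) k
  have e : b ^ k * x * b ^ (-(k + n)) = x * b ^ (-n) := by
    rw [neg_add, zpow_add₀ hb0, zpow_neg b k]
    field_simp
  rw [hg x hx n hn, hg (b ^ k * x) (by positivity) (k + n) (by rwa [e]), e, zpow_add₀ hb0]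
  ring

theorem half_closed (b : ℝ) (hb : 1 < b) (η g : ℝ → ℝ) (hη : η b = b * η 1)
    (hg : ∀ x : ℝ, 0 < x → ∀ n : ℤ, x * b ^ (-n) ∈ Set.Ico 1 b →
          g x = b ^ n * η (x * b ^ (-n))) (n : ℤ) (x : ℝ) (hx : x * b ^ (-n) ∈ Set.Icc 1 b) :
    g x = b ^ n * η (x * b ^ (-n)) := by
  have hb0 : b ≠ 0 := by linarith
  have hp : 0 < b ^ (-n) := zpow_pos (by linarith) _
  have hx0 : 0 < x := by
    by_contra h
    have := mul_nonpos_of_nonpos_of_nonneg (not_lt.1 h) hp.le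
    linarith [hx.1]
  rcases hx.2.lt_or_eq with h | h
  · exact hg x hx0 n ⟨hx.1, h⟩
  · have e : x * b ^ (-(n + 1)) = 1 := by
      rw [neg_add, zpow_add₀ hb0, ← mul_assoc, h, zpow_neg_one, mul_inv_cancel₀ hb0]
    rw [h, hη, hg x hx0 (n + 1) (by rw [e]; exact ⟨le_rfl, hb⟩), e, zpow_add_one₀ hb0]
    ring

theorem half_piece (b : ℝ) (hb : 1 < b) (η g : ℝ → ℝ) (hc : ContinuousOn η (Set.Icc 1 b))
    (hη : η b = b * η 1)
    (hg : ∀ x : ℝ, 0 < x → ∀ n : ℤ, x * b ^ (-n) ∈ Set.Ico 1 b →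
          g x = b ^ n * η (x * b ^ (-n))) (n : ℤ) :
    ContinuousOn g (Set.Icc (b ^ n) (b ^ (n + 1))) := by
  have hb0 : b ≠ 0 := by linarith
  have hp : 0 < b ^ n := zpow_pos (by linarith) _
  have hm : ∀ x ∈ Set.Icc (b ^ n) (b ^ (n + 1)), x * b ^ (-n) ∈ Set.Icc 1 b := by
    rintro x ⟨h1, h2⟩
    rw [zpow_add_one₀ hb0] at h2
    rw [zpow_neg, ← div_eq_mul_inv]
    exact ⟨by rw [le_div_iff₀ hp]; linarith, by rw [div_le_iff₀ hp]; linarith⟩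
  have : ContinuousOn (fun x => b ^ n * η (x * b ^ (-n))) (Set.Icc (b ^ n) (b ^ (n + 1))) :=
    continuousOn_const.mul (hc.comp (by fun_prop) hm)
  exact this.congr fun x hx => half_closed b hb η g hη hg n x (hm x hx)

theorem half_cont (b : ℝ) (hb : 1 < b) (η g : ℝ → ℝ) (hc : ContinuousOn η (Set.Icc 1 b))
    (hη : η b = b * η 1)
    (hg : ∀ x : ℝ, 0 < x → ∀ n : ℤ, x * b ^ (-n) ∈ Set.Ico 1 b →
          g x = b ^ n * η (x * b ^ (-n))) (x : ℝ) (hx : 0 < x) : ContinuousAt g x := by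
  obtain ⟨n, hn1, hn2⟩ := exists_mem_Ico_zpow hx hb
  have h1 := half_piece b hb η g hc hη hg (n - 1)
  have h2 := half_piece b hb η g hc hη hg n
  rw [sub_add_cancel] at h1
  have hl : b ^ (n - 1) < b ^ n := zpow_lt_zpow_right₀ hb (by lia)
  have h3 := h1.union_of_isClosed h2 isClosed_Icc isClosed_Icc
  rw [Set.Icc_union_Icc_eq_Icc hl.le (hn1.trans hn2.le)] at h3
  exact h3.continuousAt (Icc_mem_nhds (hl.trans_le hn1) hn2)

theorem half_bound (b : ℝ) (hb : 1 < b) (η g : ℝ → ℝ) (hc : ContinuousOn η (Set.Icc 1 b))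
    (hg : ∀ x : ℝ, 0 < x → ∀ n : ℤ, x * b ^ (-n) ∈ Set.Ico 1 b →
          g x = b ^ n * η (x * b ^ (-n))) : ∃ C, ∀ x, 0 < x → |g x| ≤ C * |x| := by
  obtain ⟨C, hC⟩ := isCompact_Icc.exists_bound_of_continuousOn hc
  refine ⟨C, fun x hx => ?_⟩
  obtain ⟨n, hn⟩ := half_exists b hb x hx
  have hp : 0 < b ^ n := zpow_pos (by linarith) _
  have h := hC _ (Set.Ico_subset_Icc_self hn)
  have h1 := hn.1
  rw [zpow_neg, ← div_eq_mul_inv, le_div_iff₀ hp] at h1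
  rw [hg x hx n hn, abs_mul, abs_of_pos hp, abs_of_pos hx, mul_comm]
  rw [Real.norm_eq_abs] at h
  have hC0 : 0 ≤ C := (abs_nonneg _).trans h
  calc _ ≤ C * b ^ n := by gcongr
    _ ≤ C * x := by gcongr; linarith

theorem conv_part (b : ℝ) (hb : 1 < b) (ηp ηm : ℝ → ℝ) (hcp : ContinuousOn ηp (Set.Icc 1 b))
    (hcm : ContinuousOn ηm (Set.Icc 1 b)) (hp : ηp b = b * ηp 1) (hm : ηm b = b * ηm 1)
    (g : ℝ → ℝ) (g0 : g 0 = 0)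
    (hgp : ∀ x : ℝ, 0 < x → ∀ n : ℤ, x * b ^ (-n) ∈ Set.Ico 1 b →
          g x = b ^ n * ηp (x * b ^ (-n)))
    (hgm : ∀ x : ℝ, x < 0 → ∀ n : ℤ, -x * b ^ (-n) ∈ Set.Ico 1 b →
          g x = b ^ n * ηm (-x * b ^ (-n))) : Continuous g ∧ BMult b g := by
  have hgm' : ∀ x : ℝ, 0 < x → ∀ n : ℤ, x * b ^ (-n) ∈ Set.Ico 1 b →
          (fun y => g (-y)) x = b ^ n * ηm (x * b ^ (-n)) := by
    intro x hx n hn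
    have := hgm (-x) (by linarith) n (by rwa [neg_neg])
    rwa [neg_neg] at this
  constructor
  · rw [continuous_iff_continuousAt]
    intro x
    rcases lt_trichotomy x 0 with hx | rfl | hx
    · have h := half_cont b hb ηm _ hcm hm hgm' (-x) (by linarith)
      have h2 : ContinuousAt ((fun y => g (-y)) ∘ fun y => -y) x :=
        ContinuousAt.comp (f := fun y : ℝ => -y) h continuous_neg.continuousAt
      simpa [Function.comp_def] using h2
    · obtain ⟨C, hC⟩ := half_bound b hb ηp g hcp hgp
      obtain ⟨D, hD⟩ := half_bound b hb ηm _ hcm hgm'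
      have key : ∀ x, |g x| ≤ max C D * |x| := by
        intro x
        rcases lt_trichotomy x 0 with hx | rfl | hx
        · have := hD (-x) (by linarith)
          simp only [neg_neg, abs_neg] at this
          exact this.trans (by gcongr; exact le_max_right _ _)
        · simp [g0]
        · exact (hC x hx).trans (by gcongr; exact le_max_left _ _)
      rw [ContinuousAt, g0]
      apply squeeze_zero_norm key
      have : Continuous fun x : ℝ => max C D * |x| := by fun_prop
      simpa using this.tendsto 0
    · exact half_cont b hb ηp g hcp hp hgp x hx
  · intro k x
    rcases lt_trichotomy x 0 with hx | rfl | hx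
    · have := half_mult b hb ηm _ hgm' k (-x) (by linarith)
      simpa using this
    · simp [g0]
    · exact half_mult b hb ηp g hgp k x hx

/-- Characterization of continuous `b`-multiplicative functions by two continuous functions
`η₊, η₋` on `[1, b]` with `η±(b) = b·η±(1)`, together with the converse: the piecewise
function built from such `η₊, η₋` (with value `0` at `0`) is continuous and
`b`-multiplicative. -/
theorem stmt_10 (b : ℝ) (hb : 1 < b) :
    (∀ f : ℝ → ℝ, Continuous f →
      (BMult b f ↔ f 0 = 0 ∧ ∃ ηp ηm : ℝ → ℝ,
        ContinuousOn ηp (Set.Icc 1 b) ∧ ContinuousOn ηm (Set.Icc 1 b) ∧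
        ηp b = b * ηp 1 ∧ ηm b = b * ηm 1 ∧
        (∀ x : ℝ, 0 < x → ∀ n : ℤ, x * b ^ (-n) ∈ Set.Ico 1 b →
          f x = b ^ n * ηp (x * b ^ (-n))) ∧
        (∀ x : ℝ, x < 0 → ∀ n : ℤ, -x * b ^ (-n) ∈ Set.Ico 1 b →
          f x = b ^ n * ηm (-x * b ^ (-n))))) ∧
    (∀ ηp ηm : ℝ → ℝ, ContinuousOn ηp (Set.Icc 1 b) → ContinuousOn ηm (Set.Icc 1 b) →
      ηp b = b * ηp 1 → ηm b = b * ηm 1 →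
      ∀ g : ℝ → ℝ, g 0 = 0 →
        (∀ x : ℝ, 0 < x → ∀ n : ℤ, x * b ^ (-n) ∈ Set.Ico 1 b →
          g x = b ^ n * ηp (x * b ^ (-n))) →
        (∀ x : ℝ, x < 0 → ∀ n : ℤ, -x * b ^ (-n) ∈ Set.Ico 1 b →
          g x = b ^ n * ηm (-x * b ^ (-n))) →
        Continuous g ∧ BMult b g) := by
  refine ⟨fun f hf => ⟨fun h => ?_, ?_⟩, ?_⟩
  · have hb0 : b ≠ 0 := by linarith
    have h1 : ∀ x, f (b * x) = b * f x := fun x => by simpa using h 1 x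
    refine ⟨?_, f, fun x => f (-x), hf.continuousOn, by fun_prop, ?_, ?_, ?_, ?_⟩
    · have := h1 0
      rw [mul_zero] at this
      have h2 : (b - 1) * f 0 = 0 := by linarith
      exact (mul_eq_zero.1 h2).resolve_left (by linarith)
    · simpa using h1 1
    · simpa using h1 (-1)
    · intro x _ n _
      rw [← h n, zpow_neg]
      congr 1
      field_simp
    · intro x _ n _
      simp only [neg_mul, neg_neg]
      rw [← h n, zpow_neg]
      congr 1
      field_simp
  · rintro ⟨f0, ηp, ηm, h1, h2, h3, h4, h5, h6⟩
    exact (conv_part b hb ηp ηm h1 h2 h3 h4 f f0 h5 h6).2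
  · intro ηp ηm h1 h2 h3 h4 g g0 h5 h6
    exact conv_part b hb ηp ηm h1 h2 h3 h4 g g0 h5 h6
end

section
/- Let T be a subgroup of the multiplicative group of nonzero real numbers. Every continuous T-multiplicative function f : ℝ → ℝ is linear (i.e., f(x) = f(1)·x for all x ∈ ℝ) if and only if T is dense in ℝ (i.e., the closure of T in ℝ equals ℝ). -/
/-- `T` is a subgroup of the multiplicative group of nonzero real numbers. -/
def IsMulSubgroupNZ (T : Set ℝ) : Prop :=
  (∀ x ∈ T, x ≠ 0) ∧ (1 : ℝ) ∈ T ∧ (∀ x ∈ T, ∀ y ∈ T, x * y ∈ T) ∧ (∀ x ∈ T, x⁻¹ ∈ T)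

/-- `f` is `T`-multiplicative: `f(tx) = t·f(x)` for all `t ∈ T`, `x ∈ ℝ`. -/
def TMult (T : Set ℝ) (f : ℝ → ℝ) : Prop :=
  ∀ t ∈ T, ∀ x : ℝ, f (t * x) = t * f x

lemma cont_aux (c : ℝ) : Continuous (fun x : ℝ => x * Real.cos (c * Real.log x)) := by
  rw [continuous_iff_continuousAt]
  intro x
  by_cases hx : x = 0
  · subst hx
    have h : Filter.Tendsto (fun x : ℝ => x * Real.cos (c * Real.log x)) (nhds 0) (nhds 0) := by
      apply squeeze_zero_norm (a := fun x : ℝ => ‖x‖)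
      · intro t
        rw [norm_mul]
        exact mul_le_of_le_one_right (norm_nonneg _) (Real.abs_cos_le_one _)
      · simpa using (continuous_norm (E := ℝ)).tendsto 0
    simpa [ContinuousAt] using h
  · have := Real.continuousAt_log hx
    fun_prop

lemma nonlin_aux (T : Set ℝ) (hT : ∀ x ∈ T, x ≠ 0) (c : ℝ) (hc : c ≠ 0)
    (h : ∀ t ∈ T, ∃ n : ℤ, c * Real.log t = n * (2 * Real.pi)) :
    ¬ (∀ f : ℝ → ℝ, Continuous f → TMult T f → ∀ x : ℝ, f x = f 1 * x) := by
  intro H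
  have := H (fun x : ℝ => x * Real.cos (c * Real.log x)) (cont_aux c) (by
    intro t ht x
    by_cases hx : x = 0
    · simp [hx]
    obtain ⟨n, hn⟩ := h t ht
    simp only
    rw [Real.log_mul (hT t ht) hx, mul_add, hn, add_comm, Real.cos_add_int_mul_two_pi]
    ring) (Real.exp (Real.pi / c))
  simp only [Real.log_exp, Real.log_one, mul_div_cancel₀ _ hc] at this
  simp at this
  linarith [Real.exp_pos (Real.pi / c)]

/-- Every continuous `T`-multiplicative function is linear iff `T` is dense in `ℝ`. -/
theorem stmt_11 (T : Set ℝ) (hT : IsMulSubgroupNZ T) :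
    (∀ f : ℝ → ℝ, Continuous f → TMult T f → ∀ x : ℝ, f x = f 1 * x) ↔
      closure T = Set.univ := by
  obtain ⟨h0, h1, hm, hi⟩ := hT
  constructor
  · intro H
    have hneg : ∃ s ∈ T, s < 0 := by
      by_contra! hpos
      have := H (fun x => |x|) continuous_abs (by
        intro t ht x
        simp [abs_mul, abs_of_nonneg (hpos t ht)]) (-1)
      norm_num at this
    obtain ⟨s, hs, hs0⟩ := hneg
    let S : AddSubgroup ℝ :=
      { carrier := {y | ∃ t ∈ T, Real.log t = y}
        zero_mem' := ⟨1, h1, Real.log_one⟩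
        add_mem' := by
          rintro _ _ ⟨a, ha, rfl⟩ ⟨b, hb, rfl⟩
          exact ⟨a * b, hm a ha b hb, Real.log_mul (h0 a ha) (h0 b hb)⟩
        neg_mem' := by
          rintro _ ⟨a, ha, rfl⟩
          exact ⟨a⁻¹, hi a ha, Real.log_inv a⟩ }
    rcases AddSubgroup.dense_or_cyclic S with hd | ⟨a, ha⟩
    · have hpos : ∀ x : ℝ, 0 < x → x ∈ closure {y | ∃ t ∈ T, y = t * t} := by
        intro x hx
        have hc : Continuous (fun y : ℝ => Real.exp (2 * y)) := by fun_prop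
        have hmem : Real.log x / 2 ∈ closure (S : Set ℝ) := hd _
        have := map_mem_closure (t := {y | ∃ t ∈ T, y = t * t}) hc hmem (by
          rintro _ ⟨t, ht, rfl⟩
          refine ⟨t, ht, ?_⟩
          simp only
          rw [two_mul, Real.exp_add, Real.exp_log_eq_abs (h0 t ht), abs_mul_abs_self])
        rw [show 2 * (Real.log x / 2) = Real.log x by ring, Real.exp_log hx] at this
        exact this
      have hne : ({0}ᶜ : Set ℝ) ⊆ closure T := by
        intro x hx
        rcases lt_or_gt_of_ne (show x ≠ 0 from hx) with h | h
        · have := map_mem_closure (f := fun y : ℝ => s * y) (t := T) (by fun_prop)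
            (hpos (x / s) (div_pos_of_neg_of_neg h hs0)) (by
              rintro _ ⟨t, ht, rfl⟩
              exact hm _ hs _ (hm _ ht _ ht))
          have e : s * (x / s) = x := mul_div_cancel₀ _ hs0.ne
          simpa only [e] using this
        · refine closure_mono ?_ (hpos x h)
          rintro _ ⟨t, ht, rfl⟩
          exact hm _ ht _ ht
      have hd0 : Dense ({0}ᶜ : Set ℝ) := dense_compl_singleton 0
      exact dense_iff_closure_eq.1 (dense_closure.1 (hd0.mono hne))
    · exfalso
      have key : ∀ t ∈ T, ∃ n : ℤ, Real.log t = n * a := by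
        intro t ht
        have : Real.log t ∈ S := ⟨t, ht, rfl⟩
        rw [ha, AddSubgroup.mem_closure_singleton] at this
        obtain ⟨n, hn⟩ := this
        exact ⟨n, by simpa using hn.symm⟩
      by_cases ha0 : a = 0
      · refine nonlin_aux T h0 1 one_ne_zero ?_ H
        intro t ht
        obtain ⟨n, hn⟩ := key t ht
        exact ⟨0, by simp [hn, ha0]⟩
      · refine nonlin_aux T h0 (2 * Real.pi / a) (by positivity) ?_ H
        intro t ht
        obtain ⟨n, hn⟩ := key t ht
        exact ⟨n, by rw [hn]; field_simp⟩
  · intro hd f hf hfT x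
    have : f = fun x => f 1 * x := by
      apply Continuous.ext_on (dense_iff_closure_eq.2 hd) hf (by fun_prop)
      intro t ht
      have := hfT t ht 1
      rw [mul_one] at this
      simp only [this]
      ring
    exact congrFun this x
end

section
/- Let n ≥ 1, let 𝓜 be a set of invertible real n×n matrices, let f : ℝ → ℝ, and set f₀(x) = f(x) − f(0). Then: (a) the induced map f̃ commutes with every M ∈ 𝓜 if and only if the induced map f̃₀ commutes with every M ∈ 𝓜 and the constant vector f(0)·𝟙 (all coordinates equal to f(0)) satisfies M·(f(0)𝟙) = f(0)𝟙 for every M ∈ 𝓜; in particular, either f(0) = 0 or every M ∈ 𝓜 has all row sums equal to 1. (b) If f̃ commutes with every M ∈ 𝓜, then for every M ∈ 𝓜, every row index i, every subset S of column indices with s := ∑_{j∈S} M_{ij} ≠ 0, and every x ∈ ℝ, one has f₀(s·x) = s·f₀(x); consequently f₀ is 𝓣(𝓜)-multiplicative. -/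
/-- The nonzero partial row sums `∑_{j∈S} M_{ij}` of matrices of `Ms`. -/
def rowPartialSums (n : ℕ) (Ms : Set (Matrix (Fin n) (Fin n) ℝ)) : Set ℝ :=
  {s | s ≠ 0 ∧ ∃ M ∈ Ms, ∃ i : Fin n, ∃ S : Finset (Fin n), s = ∑ j ∈ S, M i j}

/-- `𝓣(𝓜)`: the multiplicative subgroup of the nonzero reals generated by all nonzero
partial row sums of matrices of `Ms`, viewed as a subset of `ℝ`. -/
def TGen (n : ℕ) (Ms : Set (Matrix (Fin n) (Fin n) ℝ)) : Set ℝ :=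
  Units.val '' ((Subgroup.closure {u : ℝˣ | (u : ℝ) ∈ rowPartialSums n Ms} : Subgroup ℝˣ) :
    Set ℝˣ)

/-- (a) `f̃` commutes with every `M ∈ 𝓜` iff `f̃₀` does and the constant vector `f(0)·𝟙` is
fixed by every `M ∈ 𝓜`; in particular `f(0) = 0` or all row sums equal `1`.
(b) If `f̃` commutes with every `M ∈ 𝓜`, then `f₀` scales with every nonzero partial row sum,
and consequently `f₀` is `𝓣(𝓜)`-multiplicative. -/
theorem stmt_13 (n : ℕ) (hn : 1 ≤ n) (Ms : Set (Matrix (Fin n) (Fin n) ℝ))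
    (hMs : ∀ M ∈ Ms, IsUnit M) (f : ℝ → ℝ) :
    ((∀ M ∈ Ms, CommutesWith n f M) ↔
      ((∀ M ∈ Ms, CommutesWith n (fun x => f x - f 0) M) ∧
        ∀ M ∈ Ms, M.mulVec (fun _ => f 0) = fun _ => f 0)) ∧
    ((∀ M ∈ Ms, CommutesWith n f M) →
      (f 0 = 0 ∨ ∀ M ∈ Ms, ∀ i : Fin n, ∑ j, M i j = 1)) ∧
    ((∀ M ∈ Ms, CommutesWith n f M) →
      ((∀ M ∈ Ms, ∀ i : Fin n, ∀ S : Finset (Fin n), (∑ j ∈ S, M i j) ≠ 0 → ∀ x : ℝ,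
          (f ((∑ j ∈ S, M i j) * x) - f 0) = (∑ j ∈ S, M i j) * (f x - f 0)) ∧
        TMult (TGen n Ms) (fun x => f x - f 0))) := by
  have key : ∀ g : ℝ → ℝ, ∀ M : Matrix (Fin n) (Fin n) ℝ, CommutesWith n g M ↔
      ∀ (v : Fin n → ℝ) (i : Fin n), g (∑ j, M i j * v j) = ∑ j, M i j * g (v j) := by
    intro g M
    constructor
    · intro h v i
      exact congrFun (h v) i
    · intro h v
      funext i
      exact h v i
  have fixed : ∀ M : Matrix (Fin n) (Fin n) ℝ, CommutesWith n f M →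
      ∀ i, ∑ j, M i j * f 0 = f 0 := by
    intro M h i
    have := (key f M).1 h (fun _ => 0) i
    simpa using this.symm
  have comm0 : ∀ M : Matrix (Fin n) (Fin n) ℝ, CommutesWith n f M →
      ∀ (v : Fin n → ℝ) (i : Fin n),
        f (∑ j, M i j * v j) - f 0 = ∑ j, M i j * (f (v j) - f 0) := by
    intro M h v i
    simp only [mul_sub, Finset.sum_sub_distrib]
    rw [fixed M h i, (key f M).1 h v i]
  have scale : (∀ M ∈ Ms, CommutesWith n f M) →
      ∀ M ∈ Ms, ∀ i : Fin n, ∀ S : Finset (Fin n), ∀ x : ℝ,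
          (f ((∑ j ∈ S, M i j) * x) - f 0) = (∑ j ∈ S, M i j) * (f x - f 0) := by
    intro h M hM i S x
    have h1 := comm0 M (h M hM) (fun j => if j ∈ S then x else 0) i
    have e1 : ∑ j, M i j * (if j ∈ S then x else 0) = (∑ j ∈ S, M i j) * x := by
      simp [Finset.sum_mul]
    have e2 : ∑ j, M i j * (f (if j ∈ S then x else 0) - f 0)
        = (∑ j ∈ S, M i j) * (f x - f 0) := by
      rw [Finset.sum_mul, ← Finset.sum_subset (Finset.subset_univ S)]
      · exact Finset.sum_congr rfl fun j hj => by simp [hj]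
      · intro j _ hj
        simp [hj]
    rw [← e1, ← e2]
    exact h1
  refine ⟨⟨fun h => ⟨fun M hM => (key _ M).2 (comm0 M (h M hM)), fun M hM => ?_⟩, ?_⟩, ?_, ?_⟩
  · funext i
    exact fixed M (h M hM) i
  · rintro ⟨h0, h1⟩ M hM
    refine (key f M).2 fun v i => ?_
    have a := (key _ M).1 (h0 M hM) v i
    have b : ∑ j, M i j * f 0 = f 0 := congrFun (h1 M hM) i
    simp only [mul_sub, Finset.sum_sub_distrib] at a
    linarith
  · intro h
    by_cases h0 : f 0 = 0
    · exact Or.inl h0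
    · refine Or.inr fun M hM i => ?_
      have b := fixed M (h M hM) i
      rw [← Finset.sum_mul] at b
      exact mul_right_cancel₀ h0 (by rw [b, one_mul])
  · intro h
    refine ⟨fun M hM i S _ x => scale h M hM i S x, ?_⟩
    rintro t ⟨u, hu, rfl⟩
    change u ∈ Subgroup.closure _ at hu
    induction hu using Subgroup.closure_induction with
    | mem u hu =>
      intro x
      obtain ⟨_, M, hM, i, S, hs⟩ := hu
      rw [hs]
      exact scale h M hM i S x
    | one => intro x; simp
    | mul a b _ _ ha hb =>
      intro x
      have h1 := ha (b * x)
      have h2 := hb x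
      simp only at h1 h2 ⊢
      rw [Units.val_mul, mul_assoc, h1, h2, mul_assoc]
    | inv a _ ha =>
      intro x
      have h1 := ha ((a⁻¹ : ℝˣ) * x)
      simp only [Units.mul_inv_cancel_left] at h1 ⊢
      rw [h1, Units.inv_mul_cancel_left]
end

section
/- Let n ≥ 1, let 𝓜 be a subgroup of GL_n(ℝ), and set T = 𝓣(𝓜). Assume T is not dense in ℝ. Then 𝓕(𝓜) contains a function that is not affine (not of the form x ↦ ax + c) if and only if every matrix in 𝓜 is T-monomial, i.e., monomial with all nonzero entries belonging to T. -/
/-- The set of matrices underlying a subgroup of `GL_n(ℝ)`. -/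
def matSet (n : ℕ) (G : Subgroup (Matrix.GeneralLinearGroup (Fin n) ℝ)) :
    Set (Matrix (Fin n) (Fin n) ℝ) :=
  (fun M : Matrix.GeneralLinearGroup (Fin n) ℝ => (M : Matrix (Fin n) (Fin n) ℝ)) ''
    (G : Set (Matrix.GeneralLinearGroup (Fin n) ℝ))

lemma aux_between (H : Subgroup ℝˣ) (A : AddSubgroup ℝ)
    (hA : ∀ r ∈ A, ∃ u ∈ H, Real.log (u : ℝ) = r) (hd : Dense (A : Set ℝ))
    (a b : ℝ) (hab : a < b) (hb : 0 < b) : ∃ u ∈ H, a < (u : ℝ) ∧ (u : ℝ) < b := by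
  set a' := max a (b / 2) with ha'
  have ha0 : 0 < a' := lt_of_lt_of_le (by positivity) (le_max_right _ _)
  have hab' : a' < b := max_lt hab (by linarith)
  have hlog : Real.log a' / 2 < Real.log b / 2 := by
    have := Real.log_lt_log ha0 hab'
    linarith
  obtain ⟨r, hr, h1, h2⟩ := hd.exists_between hlog
  obtain ⟨u, hu, hur⟩ := hA r hr
  have hu0 : (u : ℝ) ≠ 0 := u.ne_zero
  have hpos : 0 < (u : ℝ) ^ 2 := by positivity
  have hl : Real.log ((u : ℝ) ^ 2) = 2 * r := by rw [Real.log_pow, hur]; norm_num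
  refine ⟨u ^ 2, H.pow_mem hu 2, ?_, ?_⟩
  · refine lt_of_le_of_lt (le_max_left a (b / 2)) ?_
    rw [Units.val_pow_eq_pow_val, ← Real.log_lt_log_iff ha0 hpos, hl]
    linarith
  · rw [Units.val_pow_eq_pow_val, ← Real.log_lt_log_iff hpos hb, hl]
    linarith

lemma aux_freq (H : Subgroup ℝˣ) (hnd : ¬ Dense (Units.val '' (H : Set ℝˣ)))
    (ν : ℝˣ) (hν : ν ∈ H) (hneg : (ν : ℝ) < 0) :
    ∃ w : ℝ, w ≠ 0 ∧ ∀ u ∈ H, ∃ k : ℤ, w * Real.log (u : ℝ) = k * (2 * Real.pi) := by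
  let A : AddSubgroup ℝ :=
    { carrier := {r | ∃ u ∈ H, Real.log (u : ℝ) = r}
      zero_mem' := ⟨1, H.one_mem, by simp⟩
      add_mem' := by
        rintro _ _ ⟨u, hu, rfl⟩ ⟨v, hv, rfl⟩
        exact ⟨u * v, H.mul_mem hu hv, by
          rw [Units.val_mul, Real.log_mul u.ne_zero v.ne_zero]⟩
      neg_mem' := by
        rintro _ ⟨u, hu, rfl⟩
        exact ⟨u⁻¹, H.inv_mem hu, by simp [Real.log_inv]⟩ }
  have hA : ∀ r ∈ A, ∃ u ∈ H, Real.log (u : ℝ) = r := fun r hr => hr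
  have hA' : ∀ u ∈ H, Real.log (u : ℝ) ∈ A := fun u hu => ⟨u, hu, rfl⟩
  rcases A.dense_or_cyclic with hd | ⟨c, hc⟩
  · exfalso
    apply hnd
    apply dense_of_exists_between
    intro a b hab
    rcases lt_or_ge 0 b with hb | hb
    · obtain ⟨u, hu, h1, h2⟩ := aux_between H A hA hd a b hab hb
      exact ⟨u, ⟨u, hu, rfl⟩, h1, h2⟩
    · have h3 : b / (ν : ℝ) < a / (ν : ℝ) := (div_lt_div_right_of_neg hneg).2 hab
      have h4 : 0 < a / (ν : ℝ) := div_pos_of_neg_of_neg (by linarith) hneg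
      obtain ⟨u, hu, h1, h2⟩ := aux_between H A hA hd _ _ h3 h4
      refine ⟨_, ⟨u * ν, H.mul_mem hu hν, rfl⟩, ?_, ?_⟩
      · rw [Units.val_mul]; exact (lt_div_iff_of_neg hneg).1 h2
      · rw [Units.val_mul]; exact (div_lt_iff_of_neg hneg).1 h1
  · have hk : ∀ u ∈ H, ∃ k : ℤ, k • c = Real.log (u : ℝ) := by
      intro u hu
      have := hA' u hu
      rw [hc] at this
      exact AddSubgroup.mem_closure_singleton.1 this
    by_cases h0 : c = 0
    · refine ⟨1, one_ne_zero, fun u hu => ⟨0, ?_⟩⟩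
      obtain ⟨k, hk⟩ := hk u hu
      rw [← hk, h0]; simp
    · refine ⟨2 * Real.pi / c, by positivity, fun u hu => ?_⟩
      obtain ⟨k, hk⟩ := hk u hu
      refine ⟨k, ?_⟩
      rw [← hk, zsmul_eq_mul]
      field_simp

lemma aux_cont (w : ℝ) : Continuous fun x : ℝ => x * Real.cos (w * Real.log x) := by
  rw [continuous_iff_continuousAt]
  intro x
  by_cases hx : x = 0
  · subst hx
    unfold ContinuousAt
    simp only [zero_mul]
    refine squeeze_zero_norm (a := fun x : ℝ => |x|) (fun y => ?_) ?_
    · rw [norm_mul, Real.norm_eq_abs, Real.norm_eq_abs]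
      exact mul_le_of_le_one_right (abs_nonneg _) (Real.abs_cos_le_one _)
    · have := (continuous_abs (G := ℝ)).tendsto 0
      simpa using this
  · have := Real.continuousAt_log hx
    fun_prop

lemma aux_exists (H : Subgroup ℝˣ) (hnd : ¬ Dense (Units.val '' (H : Set ℝˣ))) :
    ∃ f : ℝ → ℝ, Continuous f ∧ f 0 = 0 ∧ (∀ u ∈ H, ∀ x, f (u * x) = u * f x) ∧
      ¬ ∃ a c : ℝ, ∀ x : ℝ, f x = a * x + c := by
  by_cases h : ∃ ν ∈ H, (ν : ℝ) < 0
  · obtain ⟨ν, hν, hneg⟩ := h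
    obtain ⟨w, hw, hw'⟩ := aux_freq H hnd ν hν hneg
    refine ⟨fun x => x * Real.cos (w * Real.log x), aux_cont w, by simp, ?_, ?_⟩
    · intro u hu x
      obtain ⟨k, hk⟩ := hw' u hu
      by_cases hx : x = 0
      · simp [hx]
      · simp only
        rw [Real.log_mul u.ne_zero hx, mul_add, hk, add_comm, Real.cos_add_int_mul_two_pi]
        ring
    · rintro ⟨a, c, hac⟩
      have h0 := hac 0
      have h1 := hac 1
      have h2 := hac (Real.exp (Real.pi / w))
      have e : w * (Real.pi / w) = Real.pi := by field_simp
      simp only [Real.log_exp, e, Real.cos_pi] at h2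
      simp at h0 h1
      have := Real.exp_pos (Real.pi / w)
      rw [← h0, add_zero] at h1 h2
      rw [← h1] at h2
      linarith
  · push Not at h
    refine ⟨fun x => |x|, continuous_abs, abs_zero, ?_, ?_⟩
    · intro u hu x
      simp only
      rw [abs_mul, abs_of_nonneg (h u hu)]
    · rintro ⟨a, c, hac⟩
      have h0 := hac 0
      have h1 := hac 1
      have h2 := hac (-1)
      simp at h0 h1 h2
      linarith

lemma aux_affine (n : ℕ) (M : Matrix (Fin n) (Fin n) ℝ) (f : ℝ → ℝ) (hf : Continuous f)
    (hc : CommutesWith n f M) (i j k : Fin n) (hjk : j ≠ k) (hj : M i j ≠ 0) (hk : M i k ≠ 0) :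
    ∃ a c : ℝ, ∀ x : ℝ, f x = a * x + c := by
  have key : ∀ v : Fin n → ℝ, f (∑ l, M i l * v l) = ∑ l, M i l * f (v l) := by
    intro v
    have := congrFun (hc v) i
    simpa [inducedMap, Matrix.mulVec, dotProduct] using this
  have h0 : f 0 = ∑ l, M i l * f 0 := by simpa using key 0
  have key2 : ∀ v : Fin n → ℝ,
      f (∑ l, M i l * v l) - f 0 = ∑ l, M i l * (f (v l) - f 0) := by
    intro v
    rw [key v]
    simp only [mul_sub, Finset.sum_sub_distrib]
    rw [← h0]
  have two : ∀ x y, f (M i j * x + M i k * y) - f 0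
      = M i j * (f x - f 0) + M i k * (f y - f 0) := by
    intro x y
    have := key2 (fun l => if l = j then x else if l = k then y else 0)
    rw [Finset.sum_eq_add j k hjk (by intro c _ hc; simp [hc.1, hc.2]) (by simp) (by simp),
      Finset.sum_eq_add j k hjk (by intro c _ hc; simp [hc.1, hc.2]) (by simp) (by simp)] at this
    simpa [hjk.symm] using this
  have add : ∀ x y, f (x + y) - f 0 = (f x - f 0) + (f y - f 0) := by
    intro x y
    have h1 := two (x / M i j) (y / M i k)
    have h2 := two (x / M i j) 0
    have h3 := two 0 (y / M i k)
    rw [mul_div_cancel₀ _ hj, mul_div_cancel₀ _ hk] at h1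
    rw [mul_div_cancel₀ _ hj] at h2
    rw [mul_div_cancel₀ _ hk] at h3
    simp only [mul_zero, add_zero, zero_add, sub_self] at h2 h3
    rw [h1, h2, h3]
  let g : ℝ →+ ℝ :=
    { toFun := fun x => f x - f 0
      map_zero' := sub_self _
      map_add' := add }
  have hg : Continuous g := hf.sub continuous_const
  refine ⟨f 1 - f 0, f 0, fun x => ?_⟩
  have := map_real_smul g hg x 1
  have h : f (x • 1) - f 0 = x • (f 1 - f 0) := this
  simp only [smul_eq_mul, mul_one] at h
  linarith

lemma aux_monomial (n : ℕ) (M : Matrix (Fin n) (Fin n) ℝ) (hM : IsUnit M)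
    (h : ∀ i j k, j ≠ k → M i j ≠ 0 → M i k = 0) : IsMonomial M := by
  have hdet : M.det ≠ 0 := ((Matrix.isUnit_iff_isUnit_det M).1 hM).ne_zero
  have hrow : ∀ i, ∃ j, M i j ≠ 0 := by
    intro i
    by_contra! hc
    exact hdet (Matrix.det_eq_zero_of_row_eq_zero i hc)
  have hcol : ∀ j, ∃ i, M i j ≠ 0 := by
    intro j
    by_contra! hc
    exact hdet (Matrix.det_eq_zero_of_column_eq_zero j hc)
  choose σ hσ using hrow
  have hu : ∀ i j, M i j ≠ 0 → j = σ i := by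
    intro i j hj
    by_contra hne
    exact hσ i (h i j (σ i) hne hj)
  have hsurj : Function.Surjective σ := by
    intro j
    obtain ⟨i, hi⟩ := hcol j
    exact ⟨i, (hu i j hi).symm⟩
  have hinj : Function.Injective σ := Finite.injective_iff_surjective.2 hsurj
  refine ⟨fun i => ⟨σ i, hσ i, hu i⟩, fun j => ?_⟩
  obtain ⟨i, hi⟩ := hcol j
  refine ⟨i, hi, fun i' hi' => hinj ?_⟩
  rw [← hu i j hi, ← hu i' j hi']

/-- For a subgroup `𝓜 ≤ GL_n(ℝ)` with `T = 𝓣(𝓜)` not dense in `ℝ`: `𝓕(𝓜)` contains a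
non-affine function iff every matrix in `𝓜` is `T`-monomial. -/
theorem stmt_14 (n : ℕ) (hn : 1 ≤ n) (G : Subgroup (Matrix.GeneralLinearGroup (Fin n) ℝ))
    (hnd : ¬ Dense (TGen n (matSet n G))) :
    (∃ f ∈ Fop n (matSet n G), ¬ ∃ a c : ℝ, ∀ x : ℝ, f x = a * x + c) ↔
      ∀ M ∈ matSet n G, IsMonomial M ∧
        ∀ i j, M i j ≠ 0 → M i j ∈ TGen n (matSet n G) := by
  constructor
  · rintro ⟨f, ⟨hf, hcomm⟩, hna⟩ M hM
    constructor
    · apply aux_monomial n M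
      · obtain ⟨g, _, rfl⟩ := hM
        exact g.isUnit
      · intro i j k hjk hj
        by_contra hk
        exact hna (aux_affine n M f hf (hcomm M hM) i j k hjk hj hk)
    · intro i j hij
      refine ⟨Units.mk0 _ hij, Subgroup.subset_closure ?_, rfl⟩
      exact ⟨hij, M, hM, i, {j}, by simp⟩
  · intro h
    obtain ⟨f, hf, hf0, hfu, hna⟩ := aux_exists _ hnd
    refine ⟨f, ⟨hf, fun M hM v => ?_⟩, hna⟩
    obtain ⟨⟨hrow, _⟩, hT⟩ := h M hM
    funext i
    obtain ⟨j, hj, hu⟩ := hrow i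
    have hz : ∀ l, l ≠ j → M i l = 0 := by
      intro l hl
      by_contra hc
      exact hl (hu l hc)
    obtain ⟨u, huH, hue⟩ := hT i j hj
    simp only [inducedMap, Matrix.mulVec, dotProduct]
    rw [Finset.sum_eq_single j (by intro l _ hl; simp [hz l hl]) (by simp),
      Finset.sum_eq_single j (by intro l _ hl; simp [hz l hl]) (by simp), ← hue]
    exact hfu u huH (v j)
end

section
/- Let n ≥ 1 and let 𝓜 be a subgroup of GL_n(ℝ) such that 𝓣(𝓜) is dense in ℝ. Then every f ∈ 𝓕(𝓜) is affine, i.e., of the form f(x) = f'(0)·x + f(0) with f(x) − f(0) linear. If moreover some M ∈ 𝓜 has at least one row whose sum of entries is different from 1, then every f ∈ 𝓕(𝓜) is linear, i.e., f(x) = f(1)·x for all x. -/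
theorem row_eq (n : ℕ) (f : ℝ → ℝ) (M : Matrix (Fin n) (Fin n) ℝ) (h : CommutesWith n f M)
    (i : Fin n) (v : Fin n → ℝ) : f (∑ j, M i j * v j) = ∑ j, M i j * f (v j) := by
  have := congrFun (h v) i
  simpa [inducedMap, Matrix.mulVec, dotProduct] using this

theorem partial_eq (n : ℕ) (f : ℝ → ℝ) (M : Matrix (Fin n) (Fin n) ℝ) (h : CommutesWith n f M)
    (i : Fin n) (S : Finset (Fin n)) (x : ℝ) :
    f ((∑ j ∈ S, M i j) * x) - f 0 = (∑ j ∈ S, M i j) * (f x - f 0) := by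
  have h0 := row_eq n f M h i (fun _ => 0)
  have h1 := row_eq n f M h i (fun j => if j ∈ S then x else 0)
  have e1 : ∑ j, M i j * (if j ∈ S then x else 0) = (∑ j ∈ S, M i j) * x := by
    simp [Finset.sum_mul]
  have e2 : ∑ j, M i j * f (if j ∈ S then x else 0)
      = (∑ j ∈ S, M i j) * (f x - f 0) + ∑ j, M i j * f 0 := by
    have e3 : (∑ j ∈ S, M i j) * (f x - f 0)
        = ∑ j, M i j * (if j ∈ S then f x - f 0 else 0) := by
      simp [Finset.sum_mul]
    rw [e3, ← Finset.sum_add_distrib]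
    refine Finset.sum_congr rfl fun j _ => ?_
    split_ifs <;> ring
  rw [e1, e2, ← h0] at h1
  simp only [mul_zero, Finset.sum_const_zero] at h1
  linarith

theorem affine_aux (n : ℕ) (Ms : Set (Matrix (Fin n) (Fin n) ℝ)) (hd : Dense (TGen n Ms))
    (f : ℝ → ℝ) (hf : f ∈ Fop n Ms) (x : ℝ) : f x = (f 1 - f 0) * x + f 0 := by
  obtain ⟨hc, hM⟩ := hf
  have key : ∀ u ∈ Subgroup.closure {u : ℝˣ | (u : ℝ) ∈ rowPartialSums n Ms},
      ∀ y : ℝ, f ((u : ℝ) * y) - f 0 = u * (f y - f 0) := by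
    intro u hu
    induction hu using Subgroup.closure_induction with
    | mem u hu =>
      obtain ⟨_, M, hMm, i, S, hs⟩ := hu
      intro y
      rw [hs]
      exact partial_eq n f M (hM M hMm) i S y
    | one => simp
    | mul a b _ _ ha hb =>
      intro y
      rw [Units.val_mul, mul_assoc, ha, hb, mul_assoc]
    | inv a _ ha =>
      intro y
      have := ha ((a⁻¹ : ℝˣ) * y)
      rw [← mul_assoc, Units.mul_inv, one_mul] at this
      rw [this, ← mul_assoc, Units.inv_mul, one_mul]
  have hE : (fun t : ℝ => f t) = fun t => (f 1 - f 0) * t + f 0 := by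
    refine Continuous.ext_on hd hc (by fun_prop) ?_
    rintro t ⟨u, hu, rfl⟩
    have := key u hu 1
    rw [mul_one] at this
    simp only
    linarith
  exact congrFun hE x

/-- If `𝓣(𝓜)` is dense in `ℝ` then every `f ∈ 𝓕(𝓜)` is affine (with linear part
`x ↦ f(x) − f(0)`), and if moreover some matrix of `𝓜` has a row sum different from `1`,
every `f ∈ 𝓕(𝓜)` is linear. -/
theorem stmt_15 (n : ℕ) (hn : 1 ≤ n) (G : Subgroup (Matrix.GeneralLinearGroup (Fin n) ℝ))
    (hd : Dense (TGen n (matSet n G))) :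
    (∀ f ∈ Fop n (matSet n G), ∃ a : ℝ, ∀ x : ℝ, f x = a * x + f 0) ∧
    ((∃ M ∈ matSet n G, ∃ i : Fin n, ∑ j, M i j ≠ 1) →
      ∀ f ∈ Fop n (matSet n G), ∀ x : ℝ, f x = f 1 * x) := by
  refine ⟨fun f hf => ⟨f 1 - f 0, affine_aux n _ hd f hf⟩, ?_⟩
  rintro ⟨M, hM, i, hi⟩ f hf x
  have h0 := row_eq n f M (hf.2 M hM) i (fun _ => 0)
  simp only [mul_zero, Finset.sum_const_zero, ← Finset.sum_mul] at h0
  have hz : f 0 = 0 := by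
    by_contra hne
    exact hi (mul_right_cancel₀ hne (by rw [← h0, one_mul]))
  have := affine_aux n _ hd f hf x
  rw [hz] at this
  simpa using this
end

section
/- Let n ≥ 1 and let G be a subgroup of GL_n(ℝ) all of whose elements are monomial matrices, and suppose G is bounded (there is a constant C with |M_{ij}| ≤ C for all M ∈ G and all i, j). Then there exists a diagonal matrix B with strictly positive diagonal entries such that B·M·B⁻¹ is a signed permutation matrix for every M ∈ G. If moreover every element of G is a non-negative monomial matrix, then B·M·B⁻¹ is a permutation matrix for every M ∈ G. -/
/-- A bounded subgroup of `GL_n(ℝ)` consisting of monomial matrices is conjugate, via a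
diagonal matrix `B` with positive diagonal entries, to a group of signed permutation
matrices; if all its elements are non-negative monomial, to a group of permutation
matrices. -/
theorem stmt_16 (n : ℕ) (hn : 1 ≤ n) (G : Subgroup (Matrix.GeneralLinearGroup (Fin n) ℝ))
    (hmono : ∀ M ∈ G, IsMonomial (M : Matrix (Fin n) (Fin n) ℝ))
    (hbdd : ∃ C : ℝ, ∀ M ∈ G, ∀ i j, |(M : Matrix (Fin n) (Fin n) ℝ) i j| ≤ C) :
    ∃ d : Fin n → ℝ, (∀ i, 0 < d i) ∧
      (∀ M ∈ G, IsSignedPermMatrix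
        (Matrix.diagonal d * (M : Matrix (Fin n) (Fin n) ℝ) *
          Matrix.diagonal fun i => (d i)⁻¹)) ∧
      ((∀ M ∈ G, ∀ i j, (M : Matrix (Fin n) (Fin n) ℝ) i j ≠ 0 →
          0 < (M : Matrix (Fin n) (Fin n) ℝ) i j) →
        ∀ M ∈ G, IsPermMatrix
          (Matrix.diagonal d * (M : Matrix (Fin n) (Fin n) ℝ) *
            Matrix.diagonal fun i => (d i)⁻¹)) := by
  obtain ⟨C, hC⟩ := hbdd
  let S : Fin n → Set ℝ := fun j =>
    {x | ∃ N ∈ G, ∃ k, x = |(N : Matrix (Fin n) (Fin n) ℝ) k j|}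
  have hSb : ∀ j, BddAbove (S j) := by
    intro j
    refine ⟨C, ?_⟩
    rintro x ⟨N, hN, k, rfl⟩
    exact hC N hN k j
  have hS1 : ∀ j, (1 : ℝ) ∈ S j := fun j => ⟨1, G.one_mem, j, by simp⟩
  let d : Fin n → ℝ := fun j => sSup (S j)
  have hd : ∀ j, 0 < d j := fun j => lt_of_lt_of_le one_pos (le_csSup (hSb j) (hS1 j))
  -- one inequality
  have key : ∀ M ∈ G, ∀ i j, (M : Matrix (Fin n) (Fin n) ℝ) i j ≠ 0 →
      d i * |(M : Matrix (Fin n) (Fin n) ℝ) i j| ≤ d j := by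
    intro M hM i j hij
    have hpos := abs_pos.mpr hij
    rw [← le_div_iff₀ hpos]
    refine csSup_le ⟨1, hS1 i⟩ ?_
    rintro x ⟨N, hN, k, rfl⟩
    rw [le_div_iff₀ hpos, ← abs_mul]
    refine le_csSup (hSb j) ⟨N * M, G.mul_mem hN hM, k, ?_⟩
    rw [Matrix.GeneralLinearGroup.coe_mul, Matrix.mul_apply, Finset.sum_eq_single i]
    · intro l _ hl
      by_contra h
      exact hl (((hmono M hM).2 j).unique (right_ne_zero_of_mul h) hij)
    · simp
  have keq : ∀ M ∈ G, ∀ i j, (M : Matrix (Fin n) (Fin n) ℝ) i j ≠ 0 →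
      d i * |(M : Matrix (Fin n) (Fin n) ℝ) i j| = d j := by
    intro M hM i j hij
    refine le_antisymm (key M hM i j hij) ?_
    have h1 : (M : Matrix (Fin n) (Fin n) ℝ) i j *
        ((M⁻¹ : Matrix.GeneralLinearGroup (Fin n) ℝ) : Matrix (Fin n) (Fin n) ℝ) j i = 1 := by
      have h2 : ((M * M⁻¹ : Matrix.GeneralLinearGroup (Fin n) ℝ) :
          Matrix (Fin n) (Fin n) ℝ) i i = 1 := by
        rw [mul_inv_cancel]; simp
      rw [Matrix.GeneralLinearGroup.coe_mul, Matrix.mul_apply, Finset.sum_eq_single j] at h2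
      · exact h2
      · intro l _ hl
        by_contra h
        exact hl (((hmono M hM).1 i).unique (left_ne_zero_of_mul h) hij)
      · simp
    have h3 := key M⁻¹ (G.inv_mem hM) j i (right_ne_zero_of_mul_eq_one h1)
    have h4 := congrArg abs h1
    rw [abs_mul, abs_one] at h4
    have h5 := mul_le_mul_of_nonneg_right h3
      (abs_nonneg ((M : Matrix (Fin n) (Fin n) ℝ) i j))
    rwa [mul_assoc, mul_comm |_| |_|, h4, mul_one] at h5
  have hent : ∀ (A : Matrix (Fin n) (Fin n) ℝ) i j,
      (Matrix.diagonal d * A * Matrix.diagonal fun i => (d i)⁻¹) i j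
        = d i * A i j * (d j)⁻¹ := by
    intro A i j
    rw [Matrix.mul_diagonal, Matrix.diagonal_mul]
  have hne : ∀ (A : Matrix (Fin n) (Fin n) ℝ) i j,
      (Matrix.diagonal d * A * Matrix.diagonal fun i => (d i)⁻¹) i j ≠ 0 ↔ A i j ≠ 0 := by
    intro A i j
    rw [hent]
    simp [(hd i).ne', (hd j).ne']
  have hmon : ∀ M ∈ G, IsMonomial (Matrix.diagonal d * (M : Matrix (Fin n) (Fin n) ℝ) *
      Matrix.diagonal fun i => (d i)⁻¹) := by
    intro M hM
    unfold IsMonomial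
    simp only [hne]
    exact hmono M hM
  have habs : ∀ M ∈ G, ∀ i j, (M : Matrix (Fin n) (Fin n) ℝ) i j ≠ 0 →
      |d i * (M : Matrix (Fin n) (Fin n) ℝ) i j * (d j)⁻¹| = 1 := by
    intro M hM i j hij
    rw [abs_mul, abs_mul, abs_of_pos (hd i), keq M hM i j hij, abs_of_pos (inv_pos.mpr (hd j)),
      mul_inv_cancel₀ (hd j).ne']
  refine ⟨d, hd, fun M hM => ⟨hmon M hM, fun i j h => ?_⟩,
    fun hp M hM => ⟨hmon M hM, fun i j h => ?_⟩⟩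
  · rw [hne] at h
    rw [hent]
    exact eq_or_eq_neg_of_abs_eq (habs M hM i j h)
  · rw [hne] at h
    rw [hent]
    have h1 := habs M hM i j h
    rwa [abs_of_pos (mul_pos (mul_pos (hd i) (hp M hM i j h)) (inv_pos.mpr (hd j)))] at h1
end
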